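/- Let x: U → ℝ³ be a smooth immersed surface with unit normal N whose image x(U) is contained in a circular cone, i.e., in the image under a rigid motion of ℝ³ of C_r = {(s·r·cos θ, s·r·sin θ, s)/√(r²+1) : s > 0, θ ∈ ℝ} for some r ≠ 0. Then the normal bundle immersion f(p,t) = (x(p), t·N(p)) is a Maslovian Lagrangian immersion into ℂ³. -/

import Mathlib

noncomputable section

open scoped InnerProductSpace

/-- Euclidean 3-space. -/
abbrev E3 : Type := EuclideanSpace ℝ (Fin 3)

/-- ℝ⁶ = ℝ³ × ℝ³, identified with ℂ³. -/
abbrev V6 : Type := E3 × E3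

/-- The domain of the normal bundle immersion: ℝ² × ℝ. -/
abbrev W3 : Type := (ℝ × ℝ) × ℝ

/-- The standard inner product on ℝ⁶ = ℝ³ × ℝ³. -/
def ip6 (v w : V6) : ℝ := ⟪v.1, w.1⟫_ℝ + ⟪v.2, w.2⟫_ℝ

/-- The complex structure J(X, Y) = (−Y, X) on ℝ³ × ℝ³ = ℂ³. -/
def Jc (v : V6) : V6 := (-v.2, v.1)

/-- The normal bundle immersion f(p, t) = (x(p), t·N(p)). -/
def nbi (x N : ℝ × ℝ → E3) : W3 → V6 := fun q => (x q.1, q.2 • N q.1)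

/-- Second derivative of `g` at `q` in directions `v`, `w`. -/
def d2 (g : W3 → V6) (q v w : W3) : V6 := fderiv ℝ (fun y => fderiv ℝ g y w) q v

/-- `n` is orthogonal to the tangent space (range of the differential) of `g` at `q`. -/
def IsNormalAt (g : W3 → V6) (q : W3) (n : V6) : Prop :=
  ∀ v : W3, ip6 n (fderiv ℝ g q v) = 0

/-- `n` is the second fundamental form `h(v, w)` of `g` at `q`: the orthogonal projection of
the second derivative in directions `v`, `w` onto the orthogonal complement of the tangent
space. -/
def IsSFF (g : W3 → V6) (q v w : W3) (n : V6) : Prop :=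
  IsNormalAt g q n ∧ d2 g q v w - n ∈ Set.range ⇑(fderiv ℝ g q)

/-- `v₁, v₂, v₃` is an orthonormal frame at `q` for the metric induced by `g`. -/
def ONFrame (g : W3 → V6) (q : W3) (v₁ v₂ v₃ : W3) : Prop :=
  ip6 (fderiv ℝ g q v₁) (fderiv ℝ g q v₁) = 1 ∧
  ip6 (fderiv ℝ g q v₂) (fderiv ℝ g q v₂) = 1 ∧
  ip6 (fderiv ℝ g q v₃) (fderiv ℝ g q v₃) = 1 ∧
  ip6 (fderiv ℝ g q v₁) (fderiv ℝ g q v₂) = 0 ∧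
  ip6 (fderiv ℝ g q v₁) (fderiv ℝ g q v₃) = 0 ∧
  ip6 (fderiv ℝ g q v₂) (fderiv ℝ g q v₃) = 0

/-- `Hq` is the mean curvature vector of `g` at `q`:
`H = Σᵢ h(ẽᵢ, ẽᵢ)` for an orthonormal frame `ẽ₁, ẽ₂, ẽ₃` of the induced metric. -/
def IsMeanCurvAt (g : W3 → V6) (q : W3) (Hq : V6) : Prop :=
  ∃ v₁ v₂ v₃ : W3, ONFrame g q v₁ v₂ v₃ ∧
    ∃ n₁ n₂ n₃ : V6, IsSFF g q v₁ v₁ n₁ ∧ IsSFF g q v₂ v₂ n₂ ∧ IsSFF g q v₃ v₃ n₃ ∧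
      Hq = n₁ + n₂ + n₃

/-- `u = A_ξ v`, the shape operator of `g` at `q` with respect to the normal vector `ξ`,
characterized by `⟨dg(A_ξ v), dg(w)⟩ = ⟨h(v, w), ξ⟩` for all `w`. -/
def IsShapeAt (g : W3 → V6) (q : W3) (ξ : V6) (v u : W3) : Prop :=
  ∀ w : W3, ∀ n : V6, IsSFF g q v w n →
    ip6 (fderiv ℝ g q u) (fderiv ℝ g q w) = ip6 n ξ

/-- `g` is a Lagrangian immersion at `q`: the differential is injective and `J` maps the
tangent space onto its orthogonal complement. -/
def LagrangianAt (g : W3 → V6) (q : W3) : Prop :=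
  Function.Injective ⇑(fderiv ℝ g q) ∧
    Jc '' Set.range ⇑(fderiv ℝ g q) =
      {u : V6 | ∀ w ∈ Set.range ⇑(fderiv ℝ g q), ip6 u w = 0}

/-- The Maslovian condition at `q` for the mean curvature vector `Hq`: `Hq ≠ 0` and
`A_H(JH)` is a real scalar multiple of `JH` (expressed via the tangent vector `V`
with `dg(V) = J Hq`). -/
def MaslovianAt (g : W3 → V6) (q : W3) (Hq : V6) : Prop :=
  Hq ≠ 0 ∧ ∀ V u : W3, fderiv ℝ g q V = Jc Hq → IsShapeAt g q Hq V u → ∃ c : ℝ, u = c • V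

/-- Standard hypotheses: `U` is a connected open set, `x` is a smooth immersion on `U`, and
`N` is a smooth unit normal field along `x` on `U`. -/
structure SurfaceData (U : Set (ℝ × ℝ)) (x N : ℝ × ℝ → E3) : Prop where
  open_U : IsOpen U
  conn_U : IsConnected U
  smooth_x : ContDiffOn ℝ (⊤ : ℕ∞) x U
  smooth_N : ContDiffOn ℝ (⊤ : ℕ∞) N U
  immersion : ∀ p ∈ U, Function.Injective ⇑(fderiv ℝ x p)
  unit_N : ∀ p ∈ U, ‖N p‖ = 1
  normal_N : ∀ p ∈ U, ∀ v : ℝ × ℝ, ⟪N p, fderiv ℝ x p v⟫_ℝ = 0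

/-- `x` is minimal at `p`: the trace of the shape operator `A = −dN ∘ dx⁻¹` vanishes,
expressed via orthonormal frames of the induced metric. -/
def SurfMinimalAt (x N : ℝ × ℝ → E3) (p : ℝ × ℝ) : Prop :=
  ∀ v₁ v₂ : ℝ × ℝ,
    ⟪fderiv ℝ x p v₁, fderiv ℝ x p v₁⟫_ℝ = 1 →
    ⟪fderiv ℝ x p v₂, fderiv ℝ x p v₂⟫_ℝ = 1 →
    ⟪fderiv ℝ x p v₁, fderiv ℝ x p v₂⟫_ℝ = 0 →
    ⟪fderiv ℝ N p v₁, fderiv ℝ x p v₁⟫_ℝ + ⟪fderiv ℝ N p v₂, fderiv ℝ x p v₂⟫_ℝ = 0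

/-- A rigid motion of ℝ³: `y ↦ S y + c` with `S ∈ SO(3)`. -/
def RigidMotion (Φ : E3 → E3) : Prop :=
  ∃ (S : E3 ≃ₗᵢ[ℝ] E3) (c : E3),
    LinearMap.det (S.toLinearEquiv : E3 →ₗ[ℝ] E3) = 1 ∧ ∀ y, Φ y = S y + c

/-- The circular cone `C_r = {(s·r·cos θ, s·r·sin θ, s)/√(r²+1) : s > 0, θ ∈ ℝ}`. -/
def coneSet (r : ℝ) : Set E3 :=
  { y | ∃ s θ : ℝ, 0 < s ∧
      y 0 = s * r * Real.cos θ / Real.sqrt (r ^ 2 + 1) ∧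
      y 1 = s * r * Real.sin θ / Real.sqrt (r ^ 2 + 1) ∧
      y 2 = s / Real.sqrt (r ^ 2 + 1) }

/-- `x(U)` is contained in a round sphere. -/
def InRoundSphere (U : Set (ℝ × ℝ)) (x : ℝ × ℝ → E3) : Prop :=
  ∃ (c : E3) (ρ : ℝ), 0 < ρ ∧ ∀ p ∈ U, ‖x p - c‖ = ρ

/-- `x(U)` is contained in a circular cylinder. -/
def InCircularCylinder (U : Set (ℝ × ℝ)) (x : ℝ × ℝ → E3) : Prop :=
  ∃ (c w : E3) (ρ : ℝ), ‖w‖ = 1 ∧ 0 < ρ ∧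
    ∀ p ∈ U, ‖(x p - c) - ⟪x p - c, w⟫_ℝ • w‖ = ρ

/-- `x(U)` is contained in a circular cone: the image under a rigid motion of `C_r`, `r ≠ 0`. -/
def InCircularCone (U : Set (ℝ × ℝ)) (x : ℝ × ℝ → E3) : Prop :=
  ∃ r : ℝ, r ≠ 0 ∧ ∃ Φ : E3 → E3, RigidMotion Φ ∧ ∀ p ∈ U, x p ∈ Φ '' coneSet r

lemma exists_eq_of_inner_eq_zero {A : ℝ × ℝ →L[ℝ] E3} (hA : Function.Injective A) {n : E3}
    (hn : ‖n‖ = 1) (hnA : ∀ v, ⟪n, A v⟫_ℝ = 0) {X : E3} (hX : ⟪n, X⟫_ℝ = 0) :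
    ∃ v, A v = X := by
  have : Fact (Module.finrank ℝ E3 = 2 + 1) := ⟨by simp⟩
  have hn0 : n ≠ 0 := by
    rintro rfl
    simp at hn
  have hle : LinearMap.range (A : ℝ × ℝ →ₗ[ℝ] E3) ≤ (Submodule.span ℝ {n})ᗮ := by
    rintro _ ⟨v, rfl⟩
    exact Submodule.mem_orthogonal_singleton_iff_inner_right.2 (hnA v)
  have hfin : Module.finrank ℝ (LinearMap.range (A : ℝ × ℝ →ₗ[ℝ] E3)) =
      Module.finrank ℝ ((Submodule.span ℝ {n})ᗮ : Submodule ℝ E3) := by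
    rw [LinearMap.finrank_range_of_inj hA, Submodule.finrank_orthogonal_span_singleton (n := 2) hn0]
    simp
  have hmem : X ∈ LinearMap.range (A : ℝ × ℝ →ₗ[ℝ] E3) := by
    rw [Submodule.eq_of_le_of_finrank_eq hle hfin]
    exact Submodule.mem_orthogonal_singleton_iff_inner_right.2 hX
  exact hmem

lemma eq_zero_of_inner_eq_zero {A : ℝ × ℝ →L[ℝ] E3} (hA : Function.Injective A) {n : E3}
    (hn : ‖n‖ = 1) (hnA : ∀ v, ⟪n, A v⟫_ℝ = 0) {X : E3} (hX : ⟪n, X⟫_ℝ = 0)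
    (hXA : ∀ v, ⟪X, A v⟫_ℝ = 0) : X = 0 := by
  obtain ⟨v, rfl⟩ := exists_eq_of_inner_eq_zero hA hn hnA hX
  exact inner_self_eq_zero.1 (hXA v)

lemma exists_orthogonal_of_inner_eq_zero {n y : E3} (hn : n ≠ 0) (hy : y ≠ 0)
    (h : ⟪n, y⟫_ℝ = 0) : ∃ e : E3, e ≠ 0 ∧ ⟪n, e⟫_ℝ = 0 ∧ ⟪y, e⟫_ℝ = 0 := by
  refine ⟨!₂[n 1 * y 2 - n 2 * y 1, n 2 * y 0 - n 0 * y 2, n 0 * y 1 - n 1 * y 0], ?_, ?_, ?_⟩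
  · intro h0
    have hn' : 0 < ⟪n, n⟫_ℝ := real_inner_self_pos.2 hn
    have hy' : 0 < ⟪y, y⟫_ℝ := real_inner_self_pos.2 hy
    have h1 (i : Fin 3) := congrFun (congrArg WithLp.ofLp h0) i
    have h10 := h1 0
    have h11 := h1 1
    have h12 := h1 2
    have h2 := mul_pos hn' hy'
    simp only [PiLp.inner_apply, Fin.sum_univ_three, RCLike.inner_apply, conj_trivial] at h h2
    simp at h10 h11 h12
    have lagrange : (n 0 * n 0 + n 1 * n 1 + n 2 * n 2) * (y 0 * y 0 + y 1 * y 1 + y 2 * y 2) =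
        (y 0 * n 0 + y 1 * n 1 + y 2 * n 2) ^ 2 + (n 1 * y 2 - n 2 * y 1) ^ 2 +
        (n 2 * y 0 - n 0 * y 2) ^ 2 + (n 0 * y 1 - n 1 * y 0) ^ 2 := by ring
    rw [lagrange, h, h10, h11, h12] at h2
    simp at h2
  · simp [PiLp.inner_apply, Fin.sum_univ_three]
    ring
  · simp [PiLp.inner_apply, Fin.sum_univ_three]
    ring

section Ambient

lemma ip6_add_left (u v w : V6) : ip6 (u + v) w = ip6 u w + ip6 v w := by
  simp only [ip6, Prod.fst_add, Prod.snd_add, inner_add_left]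
  ring

lemma ip6_comm (u v : V6) : ip6 u v = ip6 v u := by
  simp only [ip6, real_inner_comm]

lemma ip6_Jc_left (u v : V6) : ip6 (Jc u) v = -ip6 u (Jc v) := by
  simp only [ip6, Jc, inner_neg_left, inner_neg_right]
  ring

lemma ip6_neg_right (u v : V6) : ip6 u (-v) = -ip6 u v := by
  simp only [ip6, Prod.fst_neg, Prod.snd_neg, inner_neg_right]
  ring

lemma Jc_Jc (u : V6) : Jc (Jc u) = -u := by
  simp [Jc, Prod.ext_iff]

lemma eq_zero_of_ip6_self {u : V6} (h : ip6 u u = 0) : u = 0 := by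
  have h1 := real_inner_self_nonneg (x := u.1)
  have h2 := real_inner_self_nonneg (x := u.2)
  unfold ip6 at h
  exact Prod.ext (inner_self_eq_zero.1 (by linarith : ⟪u.1, u.1⟫_ℝ = 0))
    (inner_self_eq_zero.1 (by linarith : ⟪u.2, u.2⟫_ℝ = 0))

end Ambient

section Lagrangian

lemma exists_isSFF (g : W3 → V6) (q v w : W3) : ∃ n, IsSFF g q v w n := by
  let K : Submodule ℝ (WithLp 2 V6) :=
    LinearMap.range ((WithLp.linearEquiv 2 ℝ V6).symm.toLinearMap ∘ₗ
      (fderiv ℝ g q : W3 →ₗ[ℝ] V6))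
  obtain ⟨_, ⟨u, rfl⟩, n, hn, h⟩ := K.exists_add_mem_mem_orthogonal (WithLp.toLp 2 (d2 g q v w))
  refine ⟨n.ofLp, fun z => ?_, u, ?_⟩
  · rw [ip6_comm]
    exact hn _ ⟨z, rfl⟩
  · have := congrArg WithLp.ofLp h
    rw [eq_sub_iff_add_eq]
    exact this.symm

variable {g : W3 → V6} {q : W3}

lemma LagrangianAt.ip6_Jc_eq_zero (h : LagrangianAt g q) (v w : W3) :
    ip6 (Jc (fderiv ℝ g q v)) (fderiv ℝ g q w) = 0 := by
  have : Jc (fderiv ℝ g q v) ∈ Jc '' Set.range ⇑(fderiv ℝ g q) := ⟨_, ⟨v, rfl⟩, rfl⟩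
  rw [h.2] at this
  exact this _ ⟨w, rfl⟩

lemma IsSFF.ip6_Jc {v w : W3} {n : V6} (hn : IsSFF g q v w n) (h : LagrangianAt g q) (z : W3) :
    ip6 n (Jc (fderiv ℝ g q z)) = ip6 (d2 g q v w) (Jc (fderiv ℝ g q z)) := by
  obtain ⟨-, u, hu⟩ := hn
  have : d2 g q v w = n + fderiv ℝ g q u := by rw [hu]; abel
  rw [this, ip6_add_left, ip6_comm (fderiv ℝ g q u), h.ip6_Jc_eq_zero, add_zero]

end Lagrangian

/-- Columns of a `3 × 3` matrix whose rows are orthonormal for the diagonal form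
`diag(k, m, 1)`. -/
lemma column_relations {k m : ℝ} (hm : 0 < m) {α β τ : Fin 3 → ℝ}
    (h : ∀ i j, k * α i * α j + m * β i * β j + τ i * τ j = if i = j then 1 else 0) :
    ∑ i, β i * β i = m⁻¹ ∧ ∑ i, α i * β i = 0 ∧ ∑ i, β i * τ i = 0 := by
  let P : Matrix (Fin 3) (Fin 3) ℝ := Matrix.of fun i => ![k * α i, m * β i, τ i]
  let Q : Matrix (Fin 3) (Fin 3) ℝ := Matrix.of ![α, β, τ]
  have hPQ : P * Q = 1 := by
    ext i j
    simp only [Matrix.mul_apply, Fin.sum_univ_three, Matrix.one_apply, ← h i j]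
    simp [P, Q]
  have hQP : Q * P = 1 := mul_eq_one_comm.1 hPQ
  have e (i j : Fin 3) := congrFun (congrFun hQP i) j
  have e11 := e 1 1
  have e01 := e 0 1
  have e12 := e 1 2
  simp [Matrix.mul_apply, Fin.sum_univ_three, P, Q] at e11 e01 e12
  simp only [Fin.sum_univ_three]
  refine ⟨?_, ?_, e12⟩
  · field_simp; linarith
  · have : m * (α 0 * β 0 + α 1 * β 1 + α 2 * β 2) = 0 := by linarith
    exact (mul_eq_zero.1 this).resolve_left hm.ne'

section Surface

variable {E : Type*} [NormedAddCommGroup E] [NormedSpace ℝ E]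
  {F : Type*} [NormedAddCommGroup F] [NormedSpace ℝ F]

lemma ContDiffAt.differentiableAt_fderiv {f : E → F} {p : E}
    (hf : ContDiffAt ℝ (⊤ : ℕ∞) f p) : DifferentiableAt ℝ (fderiv ℝ f) p :=
  (hf.fderiv_right (m := 1) (WithTop.coe_le_coe.2 (le_top : (2 : ℕ∞) ≤ ⊤))).differentiableAt (by simp)

lemma ContDiffAt.hasFDerivAt_fderiv_apply {f : E → F} {p : E}
    (hf : ContDiffAt ℝ (⊤ : ℕ∞) f p) (w : E) :
    HasFDerivAt (fun y => fderiv ℝ f y w) ((fderiv ℝ (fderiv ℝ f) p).flip w) p := by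
  convert hf.differentiableAt_fderiv.hasFDerivAt.clm_apply (hasFDerivAt_const w p) using 1
  ext; simp

lemma ContDiffAt.fderiv_fderiv_comm {f : E → F} {p : E}
    (hf : ContDiffAt ℝ (⊤ : ℕ∞) f p) (v w : E) :
    fderiv ℝ (fderiv ℝ f) p v w = fderiv ℝ (fderiv ℝ f) p w v :=
  hf.isSymmSndFDerivAt (by simpa using WithTop.coe_le_coe.2 (le_top : (2 : ℕ∞) ≤ ⊤)) v w

lemma fderiv_inner_of_eventuallyEq {u v : ℝ × ℝ → E3} {s : ℝ × ℝ → ℝ}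
    {u' v' : ℝ × ℝ →L[ℝ] E3} {s' : ℝ × ℝ →L[ℝ] ℝ} {p : ℝ × ℝ}
    (hu : HasFDerivAt u u' p) (hv : HasFDerivAt v v' p) (hs : HasFDerivAt s s' p)
    (h : (fun y => ⟪u y, v y⟫_ℝ) =ᶠ[nhds p] s) (z : ℝ × ℝ) :
    ⟪u p, v' z⟫_ℝ + ⟪u' z, v p⟫_ℝ = s' z := by
  have := ((hu.inner ℝ hv).congr_of_eventuallyEq h.symm).unique hs
  rw [← this]
  simp

end Surface

section NormalBundle

variable {U : Set (ℝ × ℝ)} {x N : ℝ × ℝ → E3}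

lemma SurfaceData.contDiffAt_x (hS : SurfaceData U x N) {p : ℝ × ℝ} (hp : p ∈ U) :
    ContDiffAt ℝ (⊤ : ℕ∞) x p :=
  hS.smooth_x.contDiffAt (hS.open_U.mem_nhds hp)

lemma SurfaceData.contDiffAt_N (hS : SurfaceData U x N) {p : ℝ × ℝ} (hp : p ∈ U) :
    ContDiffAt ℝ (⊤ : ℕ∞) N p :=
  hS.smooth_N.contDiffAt (hS.open_U.mem_nhds hp)

lemma hasFDerivAt_fst_comp {F : Type*} [NormedAddCommGroup F] [NormedSpace ℝ F]
    {f : ℝ × ℝ → F} {f' : ℝ × ℝ →L[ℝ] F} {q : W3} (hf : HasFDerivAt f f' q.1) :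
    HasFDerivAt (fun y : W3 => f y.1) (f'.comp (ContinuousLinearMap.fst ℝ (ℝ × ℝ) ℝ)) q :=
  hf.comp q hasFDerivAt_fst

lemma fderiv_nbi {q : W3} (hx : DifferentiableAt ℝ x q.1) (hN : DifferentiableAt ℝ N q.1)
    (v : W3) : fderiv ℝ (nbi x N) q v =
      (fderiv ℝ x q.1 v.1, v.2 • N q.1 + q.2 • fderiv ℝ N q.1 v.1) := by
  have h := (hasFDerivAt_fst_comp hx.hasFDerivAt).prodMk
    ((hasFDerivAt_snd (p := q)).smul (hasFDerivAt_fst_comp hN.hasFDerivAt))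
  have h' : HasFDerivAt (nbi x N) _ q := h
  rw [h'.fderiv]
  simp [add_comm]

lemma d2_nbi (hS : SurfaceData U x N) {q : W3} (hq : q.1 ∈ U) (v w : W3) :
    d2 (nbi x N) q v w =
      (fderiv ℝ (fderiv ℝ x) q.1 v.1 w.1,
        v.2 • fderiv ℝ N q.1 w.1 + w.2 • fderiv ℝ N q.1 v.1 +
          q.2 • fderiv ℝ (fderiv ℝ N) q.1 v.1 w.1) := by
  have hev : (fun y => fderiv ℝ (nbi x N) y w) =ᶠ[nhds q] fun y =>
      (fderiv ℝ x y.1 w.1, w.2 • N y.1 + y.2 • fderiv ℝ N y.1 w.1) := by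
    filter_upwards [continuous_fst.continuousAt.preimage_mem_nhds (hS.open_U.mem_nhds hq)]
      with y hy
    exact fderiv_nbi ((hS.contDiffAt_x hy).differentiableAt (by simp))
      ((hS.contDiffAt_N hy).differentiableAt (by simp)) w
  have hN := (hS.contDiffAt_N hq).differentiableAt (by simp)
  have h := (hasFDerivAt_fst_comp ((hS.contDiffAt_x hq).hasFDerivAt_fderiv_apply w.1)).prodMk
    (((hasFDerivAt_fst_comp hN.hasFDerivAt).const_smul w.2).add
    ((hasFDerivAt_snd (p := q)).smul
      (hasFDerivAt_fst_comp ((hS.contDiffAt_N hq).hasFDerivAt_fderiv_apply w.1))))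
  have h' : HasFDerivAt (fun y : W3 =>
      (fderiv ℝ x y.1 w.1, w.2 • N y.1 + y.2 • fderiv ℝ N y.1 w.1)) _ q := h
  rw [d2, hev.fderiv_eq, h'.fderiv]
  simp
  abel

lemma SurfaceData.inner_N_fderiv_N (hS : SurfaceData U x N) {p : ℝ × ℝ} (hp : p ∈ U)
    (v : ℝ × ℝ) : ⟪N p, fderiv ℝ N p v⟫_ℝ = 0 := by
  have hN := ((hS.contDiffAt_N hp).differentiableAt (by simp)).hasFDerivAt
  have h := fderiv_inner_of_eventuallyEq hN hN (hasFDerivAt_const (1 : ℝ) p) (by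
    filter_upwards [hS.open_U.mem_nhds hp] with y hy
    rw [real_inner_self_eq_norm_sq, hS.unit_N y hy, one_pow]) v
  rw [real_inner_comm (N p)] at h
  simp at h
  linarith

lemma SurfaceData.inner_fderiv_N (hS : SurfaceData U x N) {p : ℝ × ℝ} (hp : p ∈ U)
    (v w : ℝ × ℝ) : ⟪fderiv ℝ N p v, fderiv ℝ x p w⟫_ℝ =
      -⟪N p, fderiv ℝ (fderiv ℝ x) p v w⟫_ℝ := by
  have hN := ((hS.contDiffAt_N hp).differentiableAt (by simp)).hasFDerivAt
  have h := fderiv_inner_of_eventuallyEq hN ((hS.contDiffAt_x hp).hasFDerivAt_fderiv_apply w)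
    (hasFDerivAt_const (0 : ℝ) p) (by
    filter_upwards [hS.open_U.mem_nhds hp] with y hy
    exact hS.normal_N y hy w) v
  simp at h
  linarith

lemma SurfaceData.inner_fderiv_N_comm (hS : SurfaceData U x N) {p : ℝ × ℝ} (hp : p ∈ U)
    (v w : ℝ × ℝ) : ⟪fderiv ℝ N p v, fderiv ℝ x p w⟫_ℝ =
      ⟪fderiv ℝ N p w, fderiv ℝ x p v⟫_ℝ := by
  rw [hS.inner_fderiv_N hp, hS.inner_fderiv_N hp, (hS.contDiffAt_x hp).fderiv_fderiv_comm]

/-- The symmetry of the derivative of the second fundamental form of a surface. -/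
lemma SurfaceData.inner_fderiv_fderiv_N_comm (hS : SurfaceData U x N) {p : ℝ × ℝ} (hp : p ∈ U)
    (u v w : ℝ × ℝ) :
    ⟪fderiv ℝ (fderiv ℝ N) p u v, fderiv ℝ x p w⟫_ℝ -
        ⟪fderiv ℝ (fderiv ℝ x) p u v, fderiv ℝ N p w⟫_ℝ =
      ⟪fderiv ℝ (fderiv ℝ N) p u w, fderiv ℝ x p v⟫_ℝ -
        ⟪fderiv ℝ (fderiv ℝ x) p u w, fderiv ℝ N p v⟫_ℝ := by
  have hN := (hS.contDiffAt_N hp).hasFDerivAt_fderiv_apply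
  have hx := (hS.contDiffAt_x hp).hasFDerivAt_fderiv_apply
  have h := fderiv_inner_of_eventuallyEq (hN v) (hx w) ((hN w).inner ℝ (hx v)) (by
    filter_upwards [hS.open_U.mem_nhds hp] with y hy
    exact hS.inner_fderiv_N_comm hy v w) u
  simp at h
  rw [real_inner_comm (fderiv ℝ N p v), real_inner_comm (fderiv ℝ N p w)]
  linarith

lemma SurfaceData.lagrangianAt_nbi (hS : SurfaceData U x N) {q : W3} (hq : q.1 ∈ U) :
    LagrangianAt (nbi x N) q := by
  have hf := fderiv_nbi ((hS.contDiffAt_x hq).differentiableAt (by simp))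
    ((hS.contDiffAt_N hq).differentiableAt (by simp))
  have hNN : ⟪N q.1, N q.1⟫_ℝ = 1 := by
    rw [real_inner_self_eq_norm_sq, hS.unit_N _ hq, one_pow]
  have hxN (v) : ⟪fderiv ℝ x q.1 v, N q.1⟫_ℝ = 0 := by
    rw [real_inner_comm, hS.normal_N _ hq]
  refine ⟨?_, ?_⟩
  · refine (injective_iff_map_eq_zero _).2 fun v hv => ?_
    rw [hf, Prod.ext_iff] at hv
    have h1 : v.1 = 0 := hS.immersion _ hq (by simpa using hv.1)
    have h2 := hv.2
    have hN0 : N q.1 ≠ 0 := by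
      intro h0
      simp [h0] at hNN
    simp [h1, hN0] at h2
    exact Prod.ext h1 h2
  · ext u
    constructor
    · rintro ⟨_, ⟨v, rfl⟩, rfl⟩ _ ⟨w, rfl⟩
      simp only [hf, ip6, Jc, inner_neg_left, inner_add_left, inner_add_right,
        real_inner_smul_left, real_inner_smul_right, hS.normal_N _ hq, hxN,
        hS.inner_fderiv_N_comm hq v.1 w.1]
      rw [real_inner_comm (fderiv ℝ x q.1 v.1)]
      ring
    · intro hu
      have hu' (w : W3) := hu _ ⟨w, rfl⟩
      simp only [hf, ip6, inner_add_right, real_inner_smul_right] at hu'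
      obtain ⟨v, hv⟩ := exists_eq_of_inner_eq_zero (hS.immersion _ hq) (hS.unit_N _ hq)
        (hS.normal_N _ hq) (X := u.2) (by
          have := hu' (0, 1)
          simp at this
          rw [real_inner_comm, this])
      have hz : u.1 - ⟪N q.1, u.1⟫_ℝ • N q.1 + q.2 • fderiv ℝ N q.1 v = 0 := by
        refine eq_zero_of_inner_eq_zero (hS.immersion _ hq) (hS.unit_N _ hq)
          (hS.normal_N _ hq) ?_ fun w => ?_
        · simp [inner_add_right, inner_sub_right, real_inner_smul_right,
            hS.unit_N _ hq, hS.inner_N_fderiv_N hq]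
        · have := hu' (w, 0)
          simp only [inner_add_left, inner_sub_left, real_inner_smul_left, hS.normal_N _ hq,
            hS.inner_fderiv_N_comm hq v w, hv]
          simp only [← hv] at this ⊢
          rw [real_inner_comm (fderiv ℝ x q.1 v)]
          simp at this
          linarith
      refine ⟨_, ⟨(v, -⟪N q.1, u.1⟫_ℝ), rfl⟩, ?_⟩
      rw [hf]
      refine Prod.ext ?_ hv
      simp only [Jc]
      rw [← sub_eq_zero, ← neg_eq_zero, ← hz]
      module

end NormalBundle

section Cone

variable {U : Set (ℝ × ℝ)} {x N : ℝ × ℝ → E3}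

lemma exists_cone_equation {r : ℝ} (hr : r ≠ 0) {Φ : E3 → E3} (hΦ : RigidMotion Φ) :
    ∃ (c w : E3) (k : ℝ), 0 < k ∧ k < 1 ∧ ⟪w, w⟫_ℝ = 1 ∧ ∀ z ∈ Φ '' coneSet r,
      0 < ⟪z - c, w⟫_ℝ ∧ ⟪z - c, w⟫_ℝ ^ 2 = k * ⟪z - c, z - c⟫_ℝ := by
  obtain ⟨S, c, -, hΦ⟩ := hΦ
  have hr2 : 0 < r ^ 2 := by positivity
  refine ⟨c, S (EuclideanSpace.single 2 1), (r ^ 2 + 1)⁻¹, by positivity,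
    inv_lt_one_of_one_lt₀ (by linarith), by simp, ?_⟩
  rintro _ ⟨y, ⟨s, θ, hs, h0, h1, h2⟩, rfl⟩
  rw [hΦ, add_sub_cancel_right, S.inner_map_map, S.inner_map_map]
  have hw : ⟪y, EuclideanSpace.single 2 (1 : ℝ)⟫_ℝ = y 2 := by
    simp [EuclideanSpace.inner_single_right]
  have hsq : 0 < Real.sqrt (r ^ 2 + 1) := by positivity
  have hsq' : Real.sqrt (r ^ 2 + 1) ^ 2 = r ^ 2 + 1 := Real.sq_sqrt (by positivity)
  rw [hw]
  constructor
  · rw [h2]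
    positivity
  · simp only [PiLp.inner_apply, Fin.sum_univ_three, RCLike.inner_apply, conj_trivial, h0, h1, h2]
    field_simp
    linear_combination (-r ^ 2) * Real.sin_sq_add_cos_sq θ

variable {c w : E3} {k : ℝ}

/-- The cone condition: `x - c` lies on the cone with axis `w` on which `⟨y, w⟩² = k |y|²`. -/
structure OnCone (U : Set (ℝ × ℝ)) (x : ℝ × ℝ → E3) (c w : E3) (k : ℝ) : Prop where
  k_pos : 0 < k
  k_lt_one : k < 1
  axis_unit : ⟪w, w⟫_ℝ = 1
  height_pos : ∀ p ∈ U, 0 < ⟪x p - c, w⟫_ℝ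
  height_sq : ∀ p ∈ U, ⟪x p - c, w⟫_ℝ ^ 2 = k * ⟪x p - c, x p - c⟫_ℝ

lemma SurfaceData.cone_normal (hS : SurfaceData U x N) (hC : OnCone U x c w k) {p : ℝ × ℝ}
    (hp : p ∈ U) : ⟪N p, x p - c⟫_ℝ = 0 ∧ ⟪w, N p⟫_ℝ ^ 2 = 1 - k ∧
      ⟪x p - c, w⟫_ℝ • (⟪w, N p⟫_ℝ • N p - w) = -k • (x p - c) := by
  obtain ⟨y, hy⟩ : ∃ y, y = x p - c := ⟨_, rfl⟩
  obtain ⟨g, hg⟩ : ∃ g, g = ⟪y, w⟫_ℝ := ⟨_, rfl⟩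
  have hNN : ⟪N p, N p⟫_ℝ = 1 := by
    rw [real_inner_self_eq_norm_sq, hS.unit_N _ hp, one_pow]
  have hg0 : 0 < g := by rw [hg, hy]; exact hC.height_pos p hp
  have hgk : g ^ 2 = k * ⟪y, y⟫_ℝ := by rw [hg, hy]; exact hC.height_sq p hp
  have hk := hC.k_lt_one
  have hww := hC.axis_unit
  have hxd := (((hS.contDiffAt_x hp).differentiableAt (by simp)).hasFDerivAt).sub_const c
  have hd (v) : ⟪g • w - k • y, fderiv ℝ x p v⟫_ℝ = 0 := by
    have hL := hxd.inner ℝ (hasFDerivAt_const w p)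
    have h := fderiv_inner_of_eventuallyEq hxd (hxd.const_smul k) (hL.pow 2) (by
      filter_upwards [hS.open_U.mem_nhds hp] with z hz
      rw [hC.height_sq z hz, Pi.smul_apply, real_inner_smul_right]) v
    simp [inner_smul_right, ← hy, ← hg] at h
    rw [real_inner_comm y] at h
    rw [inner_sub_left, real_inner_smul_left, real_inner_smul_left,
      real_inner_comm (fderiv ℝ x p v) w]
    linarith
  have hz : g • w - k • y - ⟪N p, g • w - k • y⟫_ℝ • N p = 0 := by
    refine eq_zero_of_inner_eq_zero (hS.immersion _ hp) (hS.unit_N _ hp) (hS.normal_N _ hp)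
      ?_ fun v => ?_
    · rw [inner_sub_right, real_inner_smul_right, hNN, mul_one, sub_self]
    · rw [inner_sub_left, hd, real_inner_smul_left, hS.normal_N _ hp, mul_zero, sub_zero]
  obtain ⟨l, hl⟩ : ∃ l, l = ⟪N p, g • w - k • y⟫_ℝ := ⟨_, rfl⟩
  rw [← hl, sub_eq_zero] at hz
  have hyw : ⟪w, y⟫_ℝ = g := by rw [hg, real_inner_comm]
  have hl2 : l ^ 2 = g ^ 2 * (1 - k) := by
    have : ⟪g • w - k • y, g • w - k • y⟫_ℝ = l ^ 2 := by
      rw [hz, real_inner_smul_left, real_inner_smul_right, hNN]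
      ring
    rw [← this]
    simp only [inner_sub_left, inner_sub_right, real_inner_smul_left, real_inner_smul_right,
      hww, hyw, ← hg]
    linear_combination -k * hgk
  have hl0 : l ≠ 0 := by
    intro h0
    have : 0 < g ^ 2 * (1 - k) := mul_pos (by positivity) (by linarith)
    rw [← hl2, h0] at this
    simp at this
  have hNy : ⟪N p, y⟫_ℝ = 0 := by
    have : l * ⟪N p, y⟫_ℝ = 0 := by
      rw [← real_inner_smul_left, ← hz, inner_sub_left, real_inner_smul_left,
        real_inner_smul_left, hyw, ← sq, hgk, sub_self]
    exact (mul_eq_zero.1 this).resolve_left hl0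
  have hlw : l = g * ⟪w, N p⟫_ℝ := by
    rw [hl, inner_sub_right, real_inner_smul_right, real_inner_smul_right, hNy,
      real_inner_comm w]
    ring
  rw [← hy, ← hg]
  refine ⟨hNy, ?_, ?_⟩
  · have : g ^ 2 * (⟪w, N p⟫_ℝ ^ 2) = g ^ 2 * (1 - k) := by rw [← hl2, hlw]; ring
    exact mul_left_cancel₀ (by positivity) this
  · rw [smul_sub, smul_smul, ← hlw, ← hz]
    module

lemma SurfaceData.cone_normal_eventually (hS : SurfaceData U x N) (hC : OnCone U x c w k)
    {p : ℝ × ℝ} (hp : p ∈ U) : ∃ η : ℝ, η ≠ 0 ∧ (fun z => ⟪x z - c, w⟫_ℝ • (η • N z - w))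
      =ᶠ[nhds p] fun z => -k • (x z - c) := by
  have hk := hC.k_lt_one
  have h0 : ⟪w, N p⟫_ℝ ≠ 0 := by
    intro h
    have := (hS.cone_normal hC hp).2.1
    rw [h] at this
    linarith
  refine ⟨⟪w, N p⟫_ℝ, h0, ?_⟩
  have hcont : ContinuousAt (fun z => ⟪w, N p⟫_ℝ * ⟪w, N z⟫_ℝ) p :=
    continuousAt_const.mul (continuousAt_const.inner (hS.contDiffAt_N hp).continuousAt)
  filter_upwards [hS.open_U.mem_nhds hp, hcont.eventually_const_lt (mul_self_pos.2 h0)]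
    with z hz hz'
  have : ⟪w, N z⟫_ℝ = ⟪w, N p⟫_ℝ := by
    rcases sq_eq_sq_iff_eq_or_eq_neg.1
      ((hS.cone_normal hC hz).2.1.trans (hS.cone_normal hC hp).2.1.symm) with h | h
    · exact h
    · rw [h] at hz'
      nlinarith [mul_self_nonneg ⟪w, N p⟫_ℝ]
  rw [← this]
  exact (hS.cone_normal hC hz).2.2

end Cone

lemma fderiv_smul_apply_of_eventuallyEq {g : ℝ × ℝ → ℝ} {M Z : ℝ × ℝ → E3} {p : ℝ × ℝ}
    {g' : ℝ × ℝ →L[ℝ] ℝ} {M' Z' : ℝ × ℝ →L[ℝ] E3}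
    (hg : HasFDerivAt g g' p) (hM : HasFDerivAt M M' p) (hZ : HasFDerivAt Z Z' p)
    (h : (fun z => g z • M z) =ᶠ[nhds p] Z) (v : ℝ × ℝ) :
    g p • M' v + g' v • M p = Z' v := by
  rw [← ((hg.smul hM).congr_of_eventuallyEq h.symm).unique hZ]
  simp

section ConeFrame

variable {U : Set (ℝ × ℝ)} {x N : ℝ × ℝ → E3} {c w : E3} {k : ℝ}

/-- At each point of a surface on a cone there is an orthogonal principal frame `a`, `b`, where
`a` points along the ruling with vanishing principal curvature and `b` has principal curvature
`κ ≠ 0`; moreover the second fundamental form satisfies the Codazzi-type identities special to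
cones. -/
lemma SurfaceData.exists_cone_frame (hS : SurfaceData U x N) (hC : OnCone U x c w k)
    {p : ℝ × ℝ} (hp : p ∈ U) : ∃ (a b : ℝ × ℝ) (κ : ℝ), κ ≠ 0 ∧
      (∀ v, ∃ α β : ℝ, v = α • a + β • b) ∧ fderiv ℝ x p b ≠ 0 ∧
      ⟪fderiv ℝ x p a, fderiv ℝ x p b⟫_ℝ = 0 ∧ fderiv ℝ N p a = 0 ∧
      fderiv ℝ N p b = -κ • fderiv ℝ x p b ∧
      (∀ v, ⟪fderiv ℝ (fderiv ℝ N) p a v, fderiv ℝ x p a⟫_ℝ = 0) ∧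
      ⟪fderiv ℝ (fderiv ℝ N) p b b, fderiv ℝ x p b⟫_ℝ =
        ⟪fderiv ℝ (fderiv ℝ x) p b b, fderiv ℝ N p b⟫_ℝ := by
  have hg0 := hC.height_pos p hp
  have hn0 : N p ≠ 0 := by
    intro h
    have := hS.unit_N p hp
    simp [h] at this
  have hy0 : x p - c ≠ 0 := by
    intro h
    simp [h] at hg0
  have hxc {z} (hz : z ∈ U) :=
    (((hS.contDiffAt_x hz).differentiableAt (by simp)).hasFDerivAt).sub_const c
  have hNd {z} (hz : z ∈ U) := ((hS.contDiffAt_N hz).differentiableAt (by simp)).hasFDerivAt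
  obtain ⟨hNy, -, -⟩ := hS.cone_normal hC hp
  obtain ⟨e, he0, hne, hye⟩ := exists_orthogonal_of_inner_eq_zero hn0 hy0 hNy
  obtain ⟨a, ha⟩ := exists_eq_of_inner_eq_zero (hS.immersion _ hp) (hS.unit_N _ hp)
    (hS.normal_N _ hp) hNy
  obtain ⟨b, hb⟩ := exists_eq_of_inner_eq_zero (hS.immersion _ hp) (hS.unit_N _ hp)
    (hS.normal_N _ hp) hne
  obtain ⟨η, hη, hM⟩ := hS.cone_normal_eventually hC hp
  have hgd {z} (hz : z ∈ U) := (hxc hz).inner ℝ (hasFDerivAt_const w z)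
  have hMd {z} (hz : z ∈ U) := ((hNd hz).const_smul η).sub_const w
  have hZd {z} (hz : z ∈ U) := (hxc hz).const_smul (-k)
  have hfirst : ∀ᶠ z in nhds p, ∀ v, ⟪x z - c, w⟫_ℝ • (η • fderiv ℝ N z v) +
      ⟪fderiv ℝ x z v, w⟫_ℝ • (η • N z - w) = -k • fderiv ℝ x z v := by
    filter_upwards [hM.eventually_nhds, hS.open_U.mem_nhds hp] with z hz hzU v
    have := fderiv_smul_apply_of_eventuallyEq (hgd hzU) (hMd hzU) (hZd hzU) hz v
    simpa using this
  have hp1 := hfirst.self_of_nhds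
  have hMp : ⟪x p - c, w⟫_ℝ • (η • N p - w) = -k • (x p - c) := hM.self_of_nhds
  obtain ⟨g, hg⟩ : ∃ g, g = ⟪x p - c, w⟫_ℝ := ⟨_, rfl⟩
  rw [← hg] at hg0
  rw [← hg] at hMp
  have hMe : ⟪η • N p - w, e⟫_ℝ = 0 := by
    have h := congrArg (fun z => ⟪z, e⟫_ℝ) hMp
    simp only [real_inner_smul_left, hye, mul_zero] at h
    exact (mul_eq_zero.1 h).resolve_left hg0.ne'
  have hew : ⟪e, w⟫_ℝ = 0 := by
    rw [inner_sub_left, real_inner_smul_left, hne, mul_zero, zero_sub, neg_eq_zero] at hMe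
    rw [real_inner_comm, hMe]
  have hBa : fderiv ℝ N p a = 0 := by
    have h := hp1 a
    rw [ha, ← hg, hMp, add_eq_right, smul_smul] at h
    exact (smul_eq_zero.1 h).resolve_left (mul_ne_zero hg0.ne' hη)
  have hBb : fderiv ℝ N p b = -(k / (g * η)) • fderiv ℝ x p b := by
    have h := hp1 b
    rw [hb, hew, zero_smul, add_zero, ← hg, smul_smul] at h
    rw [hb]
    have hgη : g * η ≠ 0 := mul_ne_zero hg0.ne' hη
    apply smul_right_injective E3 hgη
    simp only
    rw [h, smul_smul]
    congr 1
    field_simp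
  refine ⟨a, b, k / (g * η), div_ne_zero hC.k_pos.ne' (mul_ne_zero hg0.ne' hη), ?_, ?_, ?_, hBa,
    hBb, ?_, ?_⟩
  · have hab : LinearIndependent ℝ ![a, b] := by
      rw [LinearIndependent.pair_iff]
      intro s t hst
      have h := congrArg (fderiv ℝ x p) hst
      simp only [map_add, map_smul, ha, hb, map_zero] at h
      have h1 := congrArg (fun z => ⟪x p - c, z⟫_ℝ) h
      have h2 := congrArg (fun z => ⟪z, e⟫_ℝ) h
      simp only [inner_add_left, inner_add_right, real_inner_smul_left, real_inner_smul_right,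
        hye, inner_zero_left, inner_zero_right, mul_zero, add_zero, zero_add] at h1 h2
      exact ⟨(mul_eq_zero.1 h1).resolve_right (inner_self_ne_zero.2 hy0),
        (mul_eq_zero.1 h2).resolve_right (inner_self_ne_zero.2 he0)⟩
    have hspan := hab.span_eq_top_of_card_eq_finrank' (by simp)
    intro v
    have hv : v ∈ Submodule.span ℝ (Set.range ![a, b]) := hspan ▸ Submodule.mem_top
    rw [Matrix.range_cons, Matrix.range_cons, Matrix.range_empty, Set.union_empty,
      Set.singleton_union, Submodule.mem_span_pair] at hv
    obtain ⟨α, β, h⟩ := hv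
    exact ⟨α, β, h.symm⟩
  · rw [hb]; exact he0
  · rw [ha, hb]; exact hye
  · intro v
    have hNv : (fun z => ⟪fderiv ℝ N z v, x z - c⟫_ℝ) =ᶠ[nhds p] fun _ => 0 := by
      filter_upwards [hS.open_U.mem_nhds hp] with z hz
      have h := fderiv_inner_of_eventuallyEq (hNd hz) (hxc hz) (hasFDerivAt_const (0 : ℝ) z) (by
        filter_upwards [hS.open_U.mem_nhds hz] with z' hz'
        exact (hS.cone_normal hC hz').1) v
      simpa [hS.normal_N z hz] using h
    have h := fderiv_inner_of_eventuallyEq ((hS.contDiffAt_N hp).hasFDerivAt_fderiv_apply v)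
      (hxc hp) (hasFDerivAt_const (0 : ℝ) p) hNv a
    have h0 : ⟪fderiv ℝ N p v, x p - c⟫_ℝ = 0 := hNv.self_of_nhds
    rw [ha, h0] at h
    rw [ha]
    simpa using h
  · have h1 := (hgd hp).smul (((hS.contDiffAt_N hp).hasFDerivAt_fderiv_apply b).const_smul η)
    have h2 := (((hS.contDiffAt_x hp).hasFDerivAt_fderiv_apply b).inner ℝ
      (hasFDerivAt_const w p)).smul (hMd hp)
    have h3 := ((hS.contDiffAt_x hp).hasFDerivAt_fderiv_apply b).const_smul (-k)
    have h4 := (h1.add h2).congr_of_eventuallyEq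
      (f₁ := fun z => -k • fderiv ℝ x z b) (hfirst.mono fun z hz => (hz b).symm)
    have h5 := congrArg (fun L => ⟪L b, e⟫_ℝ) (h4.unique h3)
    simp [hb, hew, ← hg, inner_add_left, real_inner_smul_left, hMe] at h5
    rw [hBb, hb, real_inner_smul_right]
    field_simp
    linarith

end ConeFrame

section Maslovian

variable {U : Set (ℝ × ℝ)} {x N : ℝ × ℝ → E3} {c w : E3} {k : ℝ}

/-- The cubic form `⟨h(v, w), J df(z)⟩` of the normal bundle immersion. -/
lemma SurfaceData.ip6_d2_nbi (hS : SurfaceData U x N) {q : W3} (hq : q.1 ∈ U) (v w z : W3) :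
    ip6 (d2 (nbi x N) q v w) (Jc (fderiv ℝ (nbi x N) q z)) =
      q.2 * (⟪fderiv ℝ (fderiv ℝ N) q.1 v.1 w.1, fderiv ℝ x q.1 z.1⟫_ℝ -
          ⟪fderiv ℝ (fderiv ℝ x) q.1 v.1 w.1, fderiv ℝ N q.1 z.1⟫_ℝ) +
        z.2 * ⟪fderiv ℝ N q.1 v.1, fderiv ℝ x q.1 w.1⟫_ℝ +
        v.2 * ⟪fderiv ℝ N q.1 w.1, fderiv ℝ x q.1 z.1⟫_ℝ +
        w.2 * ⟪fderiv ℝ N q.1 v.1, fderiv ℝ x q.1 z.1⟫_ℝ := by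
  rw [d2_nbi hS hq, fderiv_nbi ((hS.contDiffAt_x hq).differentiableAt (by simp))
    ((hS.contDiffAt_N hq).differentiableAt (by simp)), hS.inner_fderiv_N hq v.1 w.1,
    real_inner_comm (fderiv ℝ (fderiv ℝ x) q.1 v.1 w.1)]
  simp only [ip6, Jc, inner_neg_right, inner_add_left, inner_add_right, real_inner_smul_left,
    real_inner_smul_right]
  ring

lemma SurfaceData.maslovianAt_nbi (hS : SurfaceData U x N) (hC : OnCone U x c w k) {q : W3}
    (hq : q.1 ∈ U) {H : V6} (hH : IsMeanCurvAt (nbi x N) q H) : MaslovianAt (nbi x N) q H := by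
  have hL := hS.lagrangianAt_nbi hq
  have hC3 := hS.ip6_d2_nbi hq
  have hf := fderiv_nbi ((hS.contDiffAt_x hq).differentiableAt (by simp))
    ((hS.contDiffAt_N hq).differentiableAt (by simp))
  have hcod := hS.inner_fderiv_fderiv_N_comm hq
  have hNN : ⟪N q.1, N q.1⟫_ℝ = 1 := by
    rw [real_inner_self_eq_norm_sq, hS.unit_N _ hq, one_pow]
  have hNB := hS.inner_N_fderiv_N hq
  have hcomm := hS.inner_fderiv_N_comm hq
  obtain ⟨a, b, κ, hκ, hspan, hb0, hab, hBa, hBb, haa, hbb⟩ := hS.exists_cone_frame hC hq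
  generalize fderiv ℝ (fderiv ℝ N) q.1 = N2 at *
  generalize fderiv ℝ (fderiv ℝ x) q.1 = X2 at *
  generalize fderiv ℝ N q.1 = B at *
  generalize fderiv ℝ x q.1 = A at *
  have hBA (v) : ⟪B v, A a⟫_ℝ = 0 := by rw [hcomm, hBa, inner_zero_left]
  have hba : ⟪A b, A a⟫_ℝ = 0 := by rw [real_inner_comm, hab]
  have haab := hcod a a b
  rw [haa, hBa, inner_zero_right, sub_zero] at haab
  have he : 0 < ⟪A b, A b⟫_ℝ := real_inner_self_pos.2 hb0
  obtain ⟨e, hee⟩ : ∃ e, e = ⟪A b, A b⟫_ℝ := ⟨_, rfl⟩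
  obtain ⟨d, hd⟩ : ∃ d, d = ⟪A a, A a⟫_ℝ := ⟨_, rfl⟩
  have hNBb : ⟪N q.1, A b⟫_ℝ = 0 := by
    have := hNB b
    rw [hBb, real_inner_smul_right] at this
    exact (mul_eq_zero.1 this).resolve_left (neg_ne_zero.2 hκ)
  have hbN : ⟪A b, N q.1⟫_ℝ = 0 := by rw [real_inner_comm, hNBb]
  have hmetric (α β τ α' β' τ' : ℝ) :
      ip6 (fderiv ℝ (nbi x N) q (α • a + β • b, τ)) (fderiv ℝ (nbi x N) q (α' • a + β' • b, τ')) =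
        d * α * α' + (e * (1 + q.2 ^ 2 * κ ^ 2)) * β * β' + τ * τ' := by
    simp only [hf, ip6, map_add, map_smul, hBa, hBb, smul_zero, zero_add, inner_add_left,
      inner_add_right, real_inner_smul_left, real_inner_smul_right, hab, hba, hNN, hNBb, hbN, hee, hd]
    ring
  have hdiag_b (α β τ : ℝ) :
      ip6 (d2 (nbi x N) q (α • a + β • b, τ) (α • a + β • b, τ))
          (Jc (fderiv ℝ (nbi x N) q (b, 0))) =
        α * β * (q.2 * (⟪N2 a b, A b⟫_ℝ - ⟪X2 a b, B b⟫_ℝ + ⟪N2 b a, A b⟫_ℝ - ⟪X2 b a, B b⟫_ℝ)) +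
          β * τ * (-2 * κ * e) := by
    simp only [hC3, map_add, map_smul, add_apply,
      smul_apply, hBa, smul_zero, zero_add, inner_add_left,
      real_inner_smul_left]
    have h : ⟪B b, A b⟫_ℝ = -κ * e := by rw [hBb, real_inner_smul_left, hee]
    rw [h]
    linear_combination q.2 * α ^ 2 * haab + q.2 * β ^ 2 * hbb
  have hdiag_t (α β τ : ℝ) :
      ip6 (d2 (nbi x N) q (α • a + β • b, τ) (α • a + β • b, τ))
          (Jc (fderiv ℝ (nbi x N) q (0, 1))) = β * β * (-κ * e) := by
    simp only [hC3, map_add, map_smul, map_zero, hBa, hBb, smul_zero, zero_add, inner_zero_right,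
      inner_add_right, real_inner_smul_left, real_inner_smul_right, hba, hee]
    ring
  have hm : 0 < e * (1 + q.2 ^ 2 * κ ^ 2) := by rw [hee]; positivity
  obtain ⟨v₁, v₂, v₃, ⟨h11, h22, h33, h12, h13, h23⟩, n₁, n₂, n₃, hn₁, hn₂, hn₃, rfl⟩ := hH
  have hcoord (v : W3) : ∃ α β τ : ℝ, v = (α • a + β • b, τ) := by
    obtain ⟨α, β, h⟩ := hspan v.1
    exact ⟨α, β, v.2, Prod.ext h rfl⟩
  have hHJ (z : W3) : ip6 (n₁ + n₂ + n₃) (Jc (fderiv ℝ (nbi x N) q z)) =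
      ip6 (d2 (nbi x N) q v₁ v₁) (Jc (fderiv ℝ (nbi x N) q z)) +
      ip6 (d2 (nbi x N) q v₂ v₂) (Jc (fderiv ℝ (nbi x N) q z)) +
      ip6 (d2 (nbi x N) q v₃ v₃) (Jc (fderiv ℝ (nbi x N) q z)) := by
    rw [ip6_add_left, ip6_add_left, hn₁.ip6_Jc hL, hn₂.ip6_Jc hL, hn₃.ip6_Jc hL]
  obtain ⟨α₁, β₁, τ₁, rfl⟩ := hcoord v₁
  obtain ⟨α₂, β₂, τ₂, rfl⟩ := hcoord v₂
  obtain ⟨α₃, β₃, τ₃, rfl⟩ := hcoord v₃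
  rw [hmetric] at h11 h22 h33 h12 h13 h23
  obtain ⟨hββ, hαβ, hβτ⟩ := column_relations hm (k := d) (α := ![α₁, α₂, α₃])
    (β := ![β₁, β₂, β₃]) (τ := ![τ₁, τ₂, τ₃]) (by
      intro i j
      fin_cases i <;> fin_cases j <;> simp <;> linarith)
  simp [Fin.sum_univ_three, -mul_inv_rev] at hββ hαβ hβτ
  have hHb : ip6 (n₁ + n₂ + n₃) (Jc (fderiv ℝ (nbi x N) q (b, 0))) = 0 := by
    rw [hHJ, hdiag_b, hdiag_b, hdiag_b]
    linear_combination (q.2 * (⟪N2 a b, A b⟫_ℝ - ⟪X2 a b, B b⟫_ℝ + ⟪N2 b a, A b⟫_ℝ -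
      ⟪X2 b a, B b⟫_ℝ)) * hαβ + (-2 * κ * e) * hβτ
  have hHt : ip6 (n₁ + n₂ + n₃) (Jc (fderiv ℝ (nbi x N) q (0, 1))) ≠ 0 := by
    rw [hHJ, hdiag_t, hdiag_t, hdiag_t, ← add_mul, ← add_mul, hββ]
    rw [← hee] at he
    exact mul_ne_zero (inv_ne_zero hm.ne') (mul_ne_zero (neg_ne_zero.2 hκ) he.ne')
  generalize n₁ + n₂ + n₃ = H at *
  refine ⟨?_, fun V u hV hu => ⟨0, ?_⟩⟩
  · rintro rfl
    simp [ip6] at hHt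
  obtain ⟨α, β, τ, rfl⟩ := hcoord V
  have hβ : β = 0 := by
    have h := hmetric α β τ 0 1 0
    rw [zero_smul, zero_add, one_smul, hV, ip6_Jc_left, hHb] at h
    simp only [mul_zero, add_zero, zero_add, mul_one, neg_zero] at h
    exact (mul_eq_zero.1 h.symm).resolve_left hm.ne'
  subst hβ
  have hHV : H = -Jc (fderiv ℝ (nbi x N) q (α • a + (0 : ℝ) • b, τ)) := by
    rw [hV, Jc_Jc, neg_neg]
  have horth (z : W3) : ip6 (fderiv ℝ (nbi x N) q u) (fderiv ℝ (nbi x N) q z) = 0 := by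
    obtain ⟨n, hn⟩ := exists_isSFF (nbi x N) q (α • a + (0 : ℝ) • b, τ) z
    rw [hu z n hn, hHV, ip6_neg_right, hn.ip6_Jc hL, hC3]
    simp [hBa, haa, hBA, real_inner_smul_left, real_inner_smul_right]
  rw [zero_smul]
  exact hL.1 (by rw [map_zero]; exact eq_zero_of_ip6_self (horth u))

end Maslovian

/-- If `x(U)` is contained in a circular cone (the image of `C_r`, `r ≠ 0`,
under a rigid motion), then the normal bundle immersion is a Maslovian Lagrangian immersion
into ℂ³. -/
theorem cone_normal_bundle_maslovian (U : Set (ℝ × ℝ)) (x N : ℝ × ℝ → E3)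
    (hS : SurfaceData U x N) (r : ℝ) (hr : r ≠ 0) (Φ : E3 → E3) (hΦ : RigidMotion Φ)
    (hcone : ∀ p ∈ U, x p ∈ Φ '' coneSet r) :
    ∀ q : W3, q.1 ∈ U → LagrangianAt (nbi x N) q ∧
      ∀ Hq : V6, IsMeanCurvAt (nbi x N) q Hq → MaslovianAt (nbi x N) q Hq := by
  obtain ⟨c, w, k, hk0, hk1, hw, hC⟩ := exists_cone_equation hr hΦ
  have hC' : OnCone U x c w k :=
    ⟨hk0, hk1, hw, fun p hp => (hC _ (hcone p hp)).1, fun p hp => (hC _ (hcone p hp)).2⟩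
  exact fun q hq => ⟨hS.lagrangianAt_nbi hq, fun H hH => hS.maslovianAt_nbi hC' hq hH⟩
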